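/- arXiv:1002.3608 — 4 statements merged into one kernel-verified Lean document; each statement's English description precedes it below -/
import Mathlib

section
/- Assume arg θ_r < arg θ_n (this is the stability condition Z_Q^- of the paper). Then a nonzero representation V of the quiver Q_{χ,N} is Z-semistable if and only if V_0 = 0 or V_{j,k} = 0 for all (j,k) ∈ I (i.e. V is supported on the vertex 0). -/
/-! Quiver `Q_{χ,N}`: vertex set `{0} ⊔ I` with
`I = {(j,k) | 1 ≤ j ≤ |χ|, 1 ≤ k ≤ N}`, `k` arrows `a_{j,k,p}` from `0`
to `(j,k)`, and (when `χ > 0`) a loop `b_{j,k}` at each `(j,k)`.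
Representations over `ℂ`, subrepresentations, central charge
`Z(W) = dim W₀ · θr + (Σ_{(j,k)} k · dim W_{j,k}) · θn`, semistability. -/

/-- The index set `I`. -/
abbrev QIdx (χ : ℤ) (N : ℕ) : Type :=
  ↥((Finset.Icc 1 χ.natAbs) ×ˢ (Finset.Icc 1 N))

/-- A finite-dimensional representation of `Q_{χ,N}` over `ℂ`.  When `χ ≤ 0`
there are no loops, which we encode by requiring the loop maps to be `0`. -/
structure QRep (χ : ℤ) (N : ℕ) where
  V0 : Type
  V : QIdx χ N → Type
  [acg0 : AddCommGroup V0]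
  [mod0 : Module ℂ V0]
  [fd0 : FiniteDimensional ℂ V0]
  [acg : ∀ i, AddCommGroup (V i)]
  [mod : ∀ i, Module ℂ (V i)]
  [fd : ∀ i, FiniteDimensional ℂ (V i)]
  a : ∀ i : QIdx χ N, Fin i.val.2 → (V0 →ₗ[ℂ] V i)
  b : ∀ i : QIdx χ N, V i →ₗ[ℂ] V i
  b_eq_zero : χ ≤ 0 → ∀ i, b i = 0

attribute [instance] QRep.acg0 QRep.mod0 QRep.fd0 QRep.acg QRep.mod QRep.fd

/-- A subrepresentation of a representation of `Q_{χ,N}`. -/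
structure QSub {χ : ℤ} {N : ℕ} (M : QRep χ N) where
  S0 : Submodule ℂ M.V0
  S : ∀ i, Submodule ℂ (M.V i)
  ha : ∀ i p, Submodule.map (M.a i p) S0 ≤ S i
  hb : 0 < χ → ∀ i, Submodule.map (M.b i) (S i) ≤ S i

/-- The central charge of a representation. -/
noncomputable def QRep.Z {χ : ℤ} {N : ℕ} (M : QRep χ N) (θr θn : ℂ) : ℂ :=
  (Module.finrank ℂ M.V0 : ℂ) * θr +
    (∑ i : QIdx χ N, (i.val.2 : ℂ) * (Module.finrank ℂ (M.V i) : ℂ)) * θn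

/-- The central charge of a subrepresentation. -/
noncomputable def QSub.Z {χ : ℤ} {N : ℕ} {M : QRep χ N} (W : QSub M)
    (θr θn : ℂ) : ℂ :=
  (Module.finrank ℂ W.S0 : ℂ) * θr +
    (∑ i : QIdx χ N, (i.val.2 : ℂ) * (Module.finrank ℂ (W.S i) : ℂ)) * θn

/-- The subrepresentation `W` is zero. -/
def QSub.IsBot {χ : ℤ} {N : ℕ} {M : QRep χ N} (W : QSub M) : Prop :=
  W.S0 = ⊥ ∧ ∀ i, W.S i = ⊥

/-- The subrepresentation `W` is all of `V`. -/
def QSub.IsTop {χ : ℤ} {N : ℕ} {M : QRep χ N} (W : QSub M) : Prop :=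
  W.S0 = ⊤ ∧ ∀ i, W.S i = ⊤

/-- The representation `M` is nonzero. -/
def QRep.Nonzero {χ : ℤ} {N : ℕ} (M : QRep χ N) : Prop :=
  0 < Module.finrank ℂ M.V0 + ∑ i : QIdx χ N, Module.finrank ℂ (M.V i)

/-- `Z`-semistability: every proper nonzero subrepresentation has argument
at most that of the whole representation. -/
def QRep.Semistable {χ : ℤ} {N : ℕ} (M : QRep χ N) (θr θn : ℂ) : Prop :=
  ∀ W : QSub M, ¬ W.IsBot → ¬ W.IsTop → (W.Z θr θn).arg ≤ (M.Z θr θn).arg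

theorem aux_arg_lt {z w : ℂ} (hz : 0 < z.im) (hw : 0 < w.im) :
    z.arg < w.arg ↔ w.re * z.im < z.re * w.im := by
  have hz0 : z ≠ 0 := by rintro rfl; simp at hz
  have hw0 : w ≠ 0 := by rintro rfl; simp at hw
  have key : z.re * w.im - w.re * z.im = ‖z‖ * ‖w‖ * Real.sin (w.arg - z.arg) := by
    rw [Real.sin_sub]
    have h1 := Complex.norm_mul_cos_arg z
    have h2 := Complex.norm_mul_sin_arg z
    have h3 := Complex.norm_mul_cos_arg w
    have h4 := Complex.norm_mul_sin_arg w
    linear_combination (-w.im) * h1 + w.re * h2 + (‖z‖ * Real.sin z.arg) * h3 -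
      (‖z‖ * Real.cos z.arg) * h4
  have hp : 0 < ‖z‖ * ‖w‖ := by positivity
  have z1 := Complex.arg_le_pi z
  have w1 := Complex.arg_le_pi w
  have z0 : 0 < z.arg := by
    rcases lt_or_eq_of_le (Complex.arg_nonneg_iff.2 hz.le) with h | h
    · exact h
    · have := (Complex.arg_eq_zero_iff.1 h.symm).2
      linarith
  have w0 : 0 < w.arg := by
    rcases lt_or_eq_of_le (Complex.arg_nonneg_iff.2 hw.le) with h | h
    · exact h
    · have := (Complex.arg_eq_zero_iff.1 h.symm).2
      linarith
  constructor
  · intro h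
    have := Real.sin_pos_of_pos_of_lt_pi (x := w.arg - z.arg) (by linarith) (by linarith)
    have := mul_pos hp this
    linarith
  · intro h
    by_contra hc
    have := Real.sin_nonpos_of_nonpos_of_neg_pi_le (x := w.arg - z.arg) (by linarith) (by linarith)
    have := mul_nonpos_of_nonneg_of_nonpos hp.le this
    linarith

theorem aux_arg_comb {z w : ℂ} (hz : 0 < z.im) (hw : 0 < w.im) (h : z.arg < w.arg)
    {a b : ℕ} (ha : 0 < a) : ((a : ℂ) * z + (b : ℂ) * w).arg < w.arg := by
  have ha' : (0 : ℝ) < a := by exact_mod_cast ha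
  have hb' : (0 : ℝ) ≤ b := by positivity
  rw [aux_arg_lt hz hw] at h
  rw [aux_arg_lt _ hw]
  · simp
    nlinarith
  · simp
    positivity

theorem aux_arg_nat {w : ℂ} {b : ℕ} (hb : 0 < b) : ((b : ℂ) * w).arg = w.arg := by
  have := Complex.arg_real_mul w (r := b) (by exact_mod_cast hb)
  simpa using this

theorem aux_sum_pos {χ : ℤ} {N : ℕ} (f : QIdx χ N → ℕ) (i : QIdx χ N) (hi : 0 < f i) :
    0 < ∑ i : QIdx χ N, i.val.2 * f i := by
  apply Finset.sum_pos' (fun _ _ => Nat.zero_le _)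
  refine ⟨i, Finset.mem_univ _, Nat.mul_pos ?_ hi⟩
  have := i.2
  simp only [Finset.mem_product, Finset.mem_Icc] at this
  omega

/-- For the stability condition `Z_Q^-`
(i.e. `arg θr < arg θn`), a nonzero representation `V` of `Q_{χ,N}` is
semistable iff `V₀ = 0` or `V` is supported on the vertex `0`. -/
theorem semistable_minus_iff (χ : ℤ) (N : ℕ) (hN : 0 < N)
    (θr θn : ℂ) (hr : 0 < θr.im) (hn : 0 < θn.im) (harg : θr.arg < θn.arg)
    (M : QRep χ N) (hM : M.Nonzero) :
    M.Semistable θr θn ↔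
      (∀ x : M.V0, x = 0) ∨ (∀ i : QIdx χ N, ∀ x : M.V i, x = 0) := by
  have hMZ : M.Z θr θn = ((Module.finrank ℂ M.V0 : ℕ) : ℂ) * θr +
      ((∑ i : QIdx χ N, i.val.2 * Module.finrank ℂ (M.V i) : ℕ) : ℂ) * θn := by
    simp [QRep.Z]
  have hWZ : ∀ W : QSub M, W.Z θr θn = ((Module.finrank ℂ W.S0 : ℕ) : ℂ) * θr +
      ((∑ i : QIdx χ N, i.val.2 * Module.finrank ℂ (W.S i) : ℕ) : ℂ) * θn := by
    intro W; simp [QSub.Z]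
  constructor
  · intro hs
    by_contra hc
    push Not at hc
    obtain ⟨⟨x, hx⟩, i, y, hy⟩ := hc
    have : Nontrivial M.V0 := ⟨x, 0, hx⟩
    have : Nontrivial (M.V i) := ⟨y, 0, hy⟩
    let W : QSub M := ⟨⊥, fun _ => ⊤, by simp, by simp⟩
    have h := hs W (fun h => top_ne_bot (h.2 i)) (fun h => bot_ne_top h.1)
    rw [hMZ, hWZ] at h
    have e0 : Module.finrank ℂ W.S0 = 0 := finrank_bot ℂ M.V0
    have e1 : ∀ i, Module.finrank ℂ (W.S i) = Module.finrank ℂ (M.V i) :=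
      fun i => finrank_top ℂ (M.V i)
    simp only [e0, e1, Nat.cast_zero, zero_mul, zero_add] at h
    rw [aux_arg_nat (aux_sum_pos _ i Module.finrank_pos)] at h
    exact absurd h (not_le.2 (aux_arg_comb hr hn harg Module.finrank_pos))
  · rintro (h0 | h0) W hb -
    · have : Subsingleton M.V0 := ⟨fun x y => by rw [h0 x, h0 y]⟩
      have hS0 : W.S0 = ⊥ := Subsingleton.elim _ _
      have hi : ∃ i, W.S i ≠ ⊥ := by
        by_contra hc
        push Not at hc
        exact hb ⟨hS0, hc⟩
      obtain ⟨i, hi⟩ := hi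
      have hp : 0 < Module.finrank ℂ (W.S i) :=
        Nat.pos_of_ne_zero (fun h => hi (Submodule.finrank_eq_zero.1 h))
      have hp' := hp.trans_le (Submodule.finrank_le (W.S i))
      rw [hMZ, hWZ, Module.finrank_zero_of_subsingleton (M := M.V0),
        Module.finrank_zero_of_subsingleton (M := W.S0)]
      simp only [Nat.cast_zero, zero_mul, zero_add]
      rw [aux_arg_nat (aux_sum_pos _ i hp), aux_arg_nat (aux_sum_pos _ i hp')]
    · have hs : ∀ i, Subsingleton (M.V i) := fun i => ⟨fun x y => by rw [h0 i x, h0 i y]⟩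
      have hS : ∀ i, W.S i = ⊥ := fun i => Subsingleton.elim _ _
      have hi : W.S0 ≠ ⊥ := fun h => hb ⟨h, hS⟩
      have hp : 0 < Module.finrank ℂ W.S0 :=
        Nat.pos_of_ne_zero (fun h => hi (Submodule.finrank_eq_zero.1 h))
      have hp' := hp.trans_le (Submodule.finrank_le W.S0)
      have e1 : ∀ i, Module.finrank ℂ (M.V i) = 0 :=
        fun i => Module.finrank_zero_of_subsingleton
      have e2 : ∀ i, Module.finrank ℂ (W.S i) = 0 :=
        fun i => Module.finrank_zero_of_subsingleton
      rw [hMZ, hWZ]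
      simp only [e1, e2, mul_zero, Finset.sum_const_zero, Nat.cast_zero, zero_mul, add_zero]
      rw [aux_arg_nat hp, aux_arg_nat hp']
end

section
/- Assume arg θ_r > arg θ_n (this is the stability condition Z_Q^+ of the paper). Let V be a Z-semistable representation of the quiver Q_{χ,N} such that V_{j,k} ≠ 0 for some (j,k) ∈ I. Then the linear map f_V : V_0 → ⊕_{(j,k)∈I} ⊕_{1≤p≤k} V_{j,k} given by f_V(v) = (a_{j,k,p}(v))_{(j,k,p)} is injective. -/
theorem cross_eq_aux (z w : ℂ) :
    z.re * w.im - z.im * w.re = ‖z‖ * ‖w‖ * Real.sin (w.arg - z.arg) := by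
  rw [Real.sin_sub]
  conv_lhs => rw [← Complex.norm_mul_cos_arg z, ← Complex.norm_mul_sin_arg z,
    ← Complex.norm_mul_cos_arg w, ← Complex.norm_mul_sin_arg w]
  ring

theorem cross_nonneg_aux (z w : ℂ) (hz : 0 < z.im) (h : z.arg ≤ w.arg) :
    0 ≤ z.re * w.im - z.im * w.re := by
  rw [cross_eq_aux]
  have h1 : 0 ≤ z.arg := Complex.arg_nonneg_iff.2 hz.le
  have h2 := Complex.arg_le_pi w
  have := Real.sin_nonneg_of_nonneg_of_le_pi (x := w.arg - z.arg) (by linarith) (by linarith)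
  positivity

theorem cross_pos_aux (z w : ℂ) (hz : 0 < z.im) (hw : 0 < w.im) (h : z.arg < w.arg) :
    0 < z.re * w.im - z.im * w.re := by
  rw [cross_eq_aux]
  have h1 : 0 ≤ z.arg := Complex.arg_nonneg_iff.2 hz.le
  have h2 : w.arg < Real.pi := Complex.arg_lt_pi_iff.2 (Or.inr hw.ne')
  have := Real.sin_pos_of_pos_of_lt_pi (x := w.arg - z.arg) (by linarith) (by linarith)
  have hz0 : z ≠ 0 := by rintro rfl; simp at hz
  have hw0 : w ≠ 0 := by rintro rfl; simp at hw
  have := norm_pos_iff.2 hz0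
  have := norm_pos_iff.2 hw0
  positivity

/-- For the stability condition `Z_Q^+`
(i.e. `arg θr > arg θn`), if `V` is a semistable representation of `Q_{χ,N}`
with `V_{j,k} ≠ 0` for some `(j,k) ∈ I`, then the map
`f_V : V₀ → ⊕_{(j,k,p)} V_{j,k}`, `v ↦ (a_{j,k,p}(v))_{(j,k,p)}`, is
injective. -/
theorem fV_injective (χ : ℤ) (N : ℕ) (hN : 0 < N)
    (θr θn : ℂ) (hr : 0 < θr.im) (hn : 0 < θn.im) (harg : θn.arg < θr.arg)
    (M : QRep χ N) (hM : M.Nonzero) (hss : M.Semistable θr θn)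
    (i₀ : QIdx χ N) (x₀ : M.V i₀) (hx₀ : x₀ ≠ 0) :
    Function.Injective
      (fun v : M.V0 => fun (i : QIdx χ N) (p : Fin i.val.2) => M.a i p v) := by
  intro u w huw
  by_contra hne
  have hv : u - w ≠ 0 := sub_ne_zero.2 hne
  have hk : ∀ i p, M.a i p (u - w) = 0 := by
    intro i p
    rw [map_sub, sub_eq_zero]
    exact congrFun (congrFun huw i) p
  let W : QSub M :=
    { S0 := Submodule.span ℂ {u - w}
      S := fun _ => ⊥
      ha := by
        intro i p
        rw [Submodule.map_span, Set.image_singleton, hk]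
        simp
      hb := by
        intro _ i
        simp }
  have h := hss W
    (by
      rintro ⟨h0, -⟩
      exact hv (Submodule.span_singleton_eq_bot.1 h0))
    (by
      rintro ⟨-, h1⟩
      have h2 : (⊥ : Submodule ℂ (M.V i₀)) = ⊤ := h1 i₀
      have h3 : x₀ ∈ (⊥ : Submodule ℂ (M.V i₀)) := by rw [h2]; trivial
      exact hx₀ ((Submodule.mem_bot ℂ).1 h3))
  have hW : W.Z θr θn = θr := by
    have h1 : Module.finrank ℂ W.S0 = 1 := finrank_span_singleton hv
    have h2 : ∀ i, Module.finrank ℂ (W.S i) = 0 := fun i => finrank_bot ℂ (M.V i)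
    simp [QSub.Z, h1, h2]
  rw [hW] at h
  have hm : 0 < ∑ i : QIdx χ N, i.val.2 * Module.finrank ℂ (M.V i) := by
    apply Finset.sum_pos' (fun _ _ => Nat.zero_le _)
    refine ⟨i₀, Finset.mem_univ _, Nat.mul_pos ?_ ?_⟩
    · have := i₀.2
      rw [Finset.mem_product, Finset.mem_Icc, Finset.mem_Icc] at this
      exact this.2.1
    · haveI : Nontrivial (M.V i₀) := ⟨⟨x₀, 0, hx₀⟩⟩
      exact Module.finrank_pos
  obtain ⟨m, hm'⟩ : ∃ m, m = ∑ i : QIdx χ N, i.val.2 * Module.finrank ℂ (M.V i) := ⟨_, rfl⟩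
  have hZ : M.Z θr θn = ((Module.finrank ℂ M.V0 : ℝ) : ℂ) * θr + ((m : ℝ) : ℂ) * θn := by
    rw [hm', QRep.Z]
    push_cast
    rfl
  rw [← hm'] at hm
  have hmr : (0 : ℝ) < m := by exact_mod_cast hm
  have c1 := cross_nonneg_aux _ _ hr h
  have c2 := cross_pos_aux _ _ hn hr harg
  rw [hZ, Complex.add_re, Complex.add_im, Complex.re_ofReal_mul, Complex.re_ofReal_mul,
    Complex.im_ofReal_mul, Complex.im_ofReal_mul] at c1
  have := mul_pos hmr c2
  nlinarith
end

section
/- Assume arg θ_r > arg θ_n (the stability condition Z_Q^+). Fix a dimension vector (r, 𝐧) with 𝐧 = (𝐧_{j,k})_{(j,k)∈I} ≠ 0, and set n := Σ_{(j,k)∈I} k·𝐧_{j,k}. Then the set of isomorphism classes of Z-semistable representations of Q_{χ,N} with dimension vector (r, 𝐧) is in bijection with the set of isomorphism classes of Z-semistable representations of Q_{χ,N} with dimension vector (n − r, 𝐧). -/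
/-- Isomorphism of representations of `Q_{χ,N}`: linear isomorphisms at all
vertices commuting with the arrow maps `a_{j,k,p}` (and with the loops
`b_{j,k}` when `χ > 0`). -/
def QRep.Iso {χ : ℤ} {N : ℕ} (M M' : QRep χ N) : Prop :=
  ∃ (e0 : M.V0 ≃ₗ[ℂ] M'.V0) (e : ∀ i, M.V i ≃ₗ[ℂ] M'.V i),
    (∀ i p v, e i (M.a i p v) = M'.a i p (e0 v)) ∧
    (0 < χ → ∀ i x, e i (M.b i x) = M'.b i (e i x))

/-- Semistable representations with a prescribed dimension vector
`(r, 𝐧)`, where `r ∈ ℤ` prescribes `dim V₀`. -/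
def SemistableOfDim (χ : ℤ) (N : ℕ) (θr θn : ℂ) (r : ℤ) (nv : QIdx χ N → ℕ) :
    Type 1 :=
  {M : QRep χ N // M.Semistable θr θn ∧ (Module.finrank ℂ M.V0 : ℤ) = r ∧
    ∀ i, Module.finrank ℂ (M.V i) = nv i}

namespace QAux

theorem arg_le_iff {z w : ℂ} (hz : 0 < z.im) (hw : 0 < w.im) :
    z.arg ≤ w.arg ↔ 0 ≤ z.re * w.im - z.im * w.re := by
  have hz0 : z ≠ 0 := by rintro rfl; simp at hz
  have hw0 : w ≠ 0 := by rintro rfl; simp at hw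
  have h1 : z.re * w.im - z.im * w.re = ‖z‖ * ‖w‖ * Real.sin (w.arg - z.arg) := by
    rw [Real.sin_sub, ← Complex.norm_mul_cos_arg z, ← Complex.norm_mul_cos_arg w,
      ← Complex.norm_mul_sin_arg z, ← Complex.norm_mul_sin_arg w]
    simp only [Complex.norm_mul_cos_arg, Complex.norm_mul_sin_arg]
    rw [← Complex.norm_mul_cos_arg z, ← Complex.norm_mul_cos_arg w,
      ← Complex.norm_mul_sin_arg z, ← Complex.norm_mul_sin_arg w]
    ring
  have hp : 0 < ‖z‖ * ‖w‖ := by positivity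
  have a1 : 0 ≤ z.arg := Complex.arg_nonneg_iff.2 hz.le
  have a2 : 0 ≤ w.arg := Complex.arg_nonneg_iff.2 hw.le
  have a3 : z.arg < Real.pi := by
    rw [Complex.arg_lt_pi_iff]; exact Or.inr hz.ne'
  have a4 : w.arg < Real.pi := by
    rw [Complex.arg_lt_pi_iff]; exact Or.inr hw.ne'
  rw [h1]
  constructor
  · intro h
    exact mul_nonneg hp.le (Real.sin_nonneg_of_nonneg_of_le_pi (by linarith) (by linarith))
  · intro h
    by_contra hlt
    push Not at hlt
    have := Real.sin_neg_of_neg_of_neg_pi_lt (x := w.arg - z.arg) (by linarith) (by linarith)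
    nlinarith

theorem cross_iff {θr θn : ℂ} (hr : 0 < θr.im) (hn : 0 < θn.im) (harg : θn.arg < θr.arg)
    (a b c d : ℕ) (h1 : 0 < a + b) (h2 : 0 < c + d) :
    ((a : ℂ) * θr + (b : ℂ) * θn).arg ≤ ((c : ℂ) * θr + (d : ℂ) * θn).arg ↔ a * d ≤ b * c := by
  have key : ∀ a b : ℕ, 0 < a + b → 0 < ((a : ℂ) * θr + (b : ℂ) * θn).im := by
    intro a b h
    have : ((a : ℂ) * θr + (b : ℂ) * θn).im = a * θr.im + b * θn.im := by simp
    rw [this]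
    rcases Nat.eq_zero_or_pos a with h0 | h0
    · have : 0 < b := by omega
      positivity
    · positivity
  rw [arg_le_iff (key a b h1) (key c d h2)]
  have hx : θr.re * θn.im - θr.im * θn.re < 0 := by
    by_contra h
    push Not at h
    exact absurd ((arg_le_iff hr hn).2 h) (not_le.2 harg)
  have e : ((a : ℂ) * θr + (b : ℂ) * θn).re * ((c : ℂ) * θr + (d : ℂ) * θn).im -
      ((a : ℂ) * θr + (b : ℂ) * θn).im * ((c : ℂ) * θr + (d : ℂ) * θn).re =
      ((b : ℝ) * c - a * d) * -(θr.re * θn.im - θr.im * θn.re) := by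
    simp
    ring
  rw [e, mul_nonneg_iff_of_pos_right (by linarith), sub_nonneg]
  exact_mod_cast Iff.rfl

variable {χ : ℤ} {N : ℕ}

theorem idx_pos (i : QIdx χ N) : 0 < i.val.2 := by
  have := i.2
  rw [Finset.mem_product, Finset.mem_Icc, Finset.mem_Icc] at this
  omega

noncomputable def wn (M : QRep χ N) : ℕ :=
  ∑ i : QIdx χ N, i.val.2 * Module.finrank ℂ (M.V i)

noncomputable def swn {M : QRep χ N} (W : QSub M) : ℕ :=
  ∑ i : QIdx χ N, i.val.2 * Module.finrank ℂ (W.S i)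

theorem semistable_iff {θr θn : ℂ} (hr : 0 < θr.im) (hn : 0 < θn.im) (harg : θn.arg < θr.arg)
    (M : QRep χ N) (hM : 0 < wn M) :
    M.Semistable θr θn ↔ ∀ W : QSub M,
      Module.finrank ℂ W.S0 * wn M ≤ swn W * Module.finrank ℂ M.V0 := by
  have hZM : M.Z θr θn = (Module.finrank ℂ M.V0 : ℂ) * θr + (wn M : ℂ) * θn := by
    simp [QRep.Z, wn]
  have hZW : ∀ W : QSub M, W.Z θr θn = (Module.finrank ℂ W.S0 : ℂ) * θr + (swn W : ℂ) * θn := by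
    intro W; simp [QSub.Z, swn]
  have hpos : ∀ W : QSub M, ¬ W.IsBot → 0 < Module.finrank ℂ W.S0 + swn W := by
    intro W hW
    by_contra h
    apply hW
    have h1 : Module.finrank ℂ W.S0 = 0 := by omega
    have h2 : swn W = 0 := by omega
    refine ⟨Submodule.finrank_eq_zero.1 h1, fun i => ?_⟩
    have := (Finset.sum_eq_zero_iff.1 h2) i (Finset.mem_univ i)
    have hi := idx_pos i
    rcases Nat.mul_eq_zero.1 this with h | h
    · omega
    · exact Submodule.finrank_eq_zero.1 h
  constructor
  · intro h W
    by_cases hb : W.IsBot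
    · rw [hb.1, finrank_bot, zero_mul]
      exact Nat.zero_le _
    by_cases ht : W.IsTop
    · have e1 : swn W = wn M := by
        unfold swn wn
        refine Finset.sum_congr rfl fun i _ => ?_
        rw [ht.2 i, finrank_top]
      rw [e1, ht.1, finrank_top, mul_comm]
    have := h W hb ht
    rwa [hZM, hZW, cross_iff hr hn harg _ _ _ _ (hpos W hb) (by omega)] at this
  · intro h W hb ht
    rw [hZM, hZW, cross_iff hr hn harg _ _ _ _ (hpos W hb) (by omega)]
    exact h W

/-- pairing map restricted to a family of subspaces of the duals -/
noncomputable def gW (M : QRep χ N) (S : ∀ i, Submodule ℂ (Module.Dual ℂ (M.V i))) :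
    (∀ i : QIdx χ N, Fin i.val.2 → S i) →ₗ[ℂ] Module.Dual ℂ M.V0 :=
  ∑ i, ∑ p, (M.a i p).dualMap ∘ₗ (S i).subtype ∘ₗ LinearMap.proj p ∘ₗ LinearMap.proj i

noncomputable def g (M : QRep χ N) :
    (∀ i : QIdx χ N, Fin i.val.2 → Module.Dual ℂ (M.V i)) →ₗ[ℂ] Module.Dual ℂ M.V0 :=
  ∑ i, ∑ p, (M.a i p).dualMap ∘ₗ LinearMap.proj p ∘ₗ LinearMap.proj i

theorem g_apply (M : QRep χ N) (φ) (v : M.V0) :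
    g M φ v = ∑ i, ∑ p, φ i p (M.a i p v) := by
  simp [g, LinearMap.sum_apply]

theorem gW_apply (M : QRep χ N) (S) (φ) (v : M.V0) :
    gW M S φ v = ∑ i, ∑ p, (φ i p : Module.Dual ℂ (M.V i)) (M.a i p v) := by
  simp [gW, LinearMap.sum_apply]

theorem gW_single (M : QRep χ N) (S) (i : QIdx χ N) (p : Fin i.val.2) (x : S i) (v : M.V0) :
    gW M S (Pi.single i (Pi.single p x)) v = (x : Module.Dual ℂ (M.V i)) (M.a i p v) := by
  rw [gW_apply, Finset.sum_eq_single i, Finset.sum_eq_single p]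
  · simp
  · intro q _ hq; simp [Pi.single_eq_of_ne hq]
  · simp
  · intro j _ hj; simp [Pi.single_eq_of_ne hj]
  · simp

theorem g_single (M : QRep χ N) (i : QIdx χ N) (p : Fin i.val.2) (x : Module.Dual ℂ (M.V i))
    (v : M.V0) :
    g M (Pi.single i (Pi.single p x)) v = x (M.a i p v) := by
  rw [g_apply, Finset.sum_eq_single i, Finset.sum_eq_single p]
  · simp
  · intro q _ hq; simp [Pi.single_eq_of_ne hq]
  · simp
  · intro j _ hj; simp [Pi.single_eq_of_ne hj]
  · simp

/-- the reflected dual representation -/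
noncomputable def D (M : QRep χ N) : QRep χ N where
  V0 := LinearMap.ker (g M)
  V := fun i => Module.Dual ℂ (M.V i)
  a := fun i p => LinearMap.proj p ∘ₗ LinearMap.proj i ∘ₗ (LinearMap.ker (g M)).subtype
  b := fun i => (M.b i).dualMap
  b_eq_zero := fun h i => by rw [M.b_eq_zero h i]; ext; simp

theorem D_a (M : QRep χ N) (i p) (φ : LinearMap.ker (g M)) : (D M).a i p φ = φ.1 i p := rfl

theorem wn_D (M : QRep χ N) : wn (D M) = wn M := by
  unfold wn
  refine Finset.sum_congr rfl fun i _ => ?_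
  congr 1
  exact Subspace.dual_finrank_eq

def Inj (M : QRep χ N) : Prop := ∀ v : M.V0, (∀ i p, M.a i p v = 0) → v = 0

theorem D_inj (M : QRep χ N) : Inj (D M) := by
  intro v h
  apply Subtype.ext
  funext i p
  exact h i p

theorem finrank_D {M : QRep χ N} (h : Inj M) :
    Module.finrank ℂ M.V0 + Module.finrank ℂ (D M).V0 = wn M := by
  have h1 := LinearMap.finrank_range_add_finrank_ker (g M)
  have h2 := Subspace.finrank_add_finrank_dualCoannihilator_eq (LinearMap.range (g M))
  have h3 : (LinearMap.range (g M)).dualCoannihilator = ⊥ := by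
    rw [eq_bot_iff]
    intro v hv
    rw [Submodule.mem_dualCoannihilator] at hv
    refine h v fun i p => ?_
    rw [← Module.forall_dual_apply_eq_zero_iff ℂ]
    intro x
    rw [← g_single]
    exact hv _ ⟨_, rfl⟩
  rw [h3, finrank_bot] at h2
  have h4 : Module.finrank ℂ (∀ i : QIdx χ N, Fin i.val.2 → Module.Dual ℂ (M.V i)) = wn M := by
    rw [Module.finrank_pi_fintype]
    unfold wn
    refine Finset.sum_congr rfl fun i _ => ?_
    rw [Module.finrank_pi_fintype]
    simp [Subspace.dual_finrank_eq]
  have h5 : Module.finrank ℂ (D M).V0 = Module.finrank ℂ (LinearMap.ker (g M)) := rfl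
  omega

theorem inj_of_crit {M : QRep χ N} (hM : 0 < wn M)
    (h : ∀ W : QSub M, Module.finrank ℂ W.S0 * wn M ≤ swn W * Module.finrank ℂ M.V0) :
    Inj M := by
  let W : QSub M :=
    { S0 := ⨅ i, ⨅ p, LinearMap.ker (M.a i p)
      S := fun _ => ⊥
      ha := by
        intro i p
        rw [Submodule.map_le_iff_le_comap]
        intro v hv
        simp only [Submodule.mem_iInf] at hv
        exact hv i p
      hb := by intro _ i; simp }
  have h1 := h W
  have h2 : swn W = 0 := by
    unfold swn
    refine Finset.sum_eq_zero fun i _ => ?_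
    simp [W]
  rw [h2, zero_mul] at h1
  have h3 : Module.finrank ℂ W.S0 = 0 := by
    rcases Nat.mul_eq_zero.1 (Nat.le_zero.1 h1) with h | h
    · exact h
    · omega
  have h4 : W.S0 = ⊥ := Submodule.finrank_eq_zero.1 h3
  intro v hv
  have : v ∈ W.S0 := by
    simp only [W, Submodule.mem_iInf]
    exact hv
  rw [h4] at this
  simpa using this

theorem crit_D {M : QRep χ N} (hM : 0 < wn M)
    (h : ∀ W : QSub M, Module.finrank ℂ W.S0 * wn M ≤ swn W * Module.finrank ℂ M.V0)
    (W' : QSub (D M)) :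
    Module.finrank ℂ W'.S0 * wn (D M) ≤ swn W' * Module.finrank ℂ (D M).V0 := by
  have hinj := inj_of_crit hM h
  have hdim := finrank_D hinj
  let S : ∀ i, Submodule ℂ (Module.Dual ℂ (M.V i)) := W'.S
  let W : QSub M :=
    { S0 := (LinearMap.range (gW M S)).dualCoannihilator
      S := fun i => (S i).dualCoannihilator
      ha := by
        intro i p
        rw [Submodule.map_le_iff_le_comap]
        intro v hv
        rw [Submodule.mem_dualCoannihilator] at hv
        rw [Submodule.mem_comap, Submodule.mem_dualCoannihilator]
        intro x hx
        rw [← gW_single M S i p ⟨x, hx⟩ v]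
        exact hv _ ⟨_, rfl⟩
      hb := by
        intro hχ i
        rw [Submodule.map_le_iff_le_comap]
        intro v hv
        rw [Submodule.mem_dualCoannihilator] at hv
        rw [Submodule.mem_comap, Submodule.mem_dualCoannihilator]
        intro x hx
        exact hv _ (W'.hb hχ i (Submodule.mem_map_of_mem hx)) }
  have hW := h W
  have h1 := LinearMap.finrank_range_add_finrank_ker (gW M S)
  have h2 : Module.finrank ℂ (LinearMap.range (gW M S)) + Module.finrank ℂ W.S0 =
      Module.finrank ℂ M.V0 :=
    Subspace.finrank_add_finrank_dualCoannihilator_eq (LinearMap.range (gW M S))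
  have h4 : Module.finrank ℂ (∀ i : QIdx χ N, Fin i.val.2 → S i) = swn W' := by
    rw [Module.finrank_pi_fintype]
    unfold swn
    refine Finset.sum_congr rfl fun i _ => ?_
    rw [Module.finrank_pi_fintype]
    simp only [Finset.sum_const, Finset.card_univ, Fintype.card_fin, smul_eq_mul]
    rfl
  have h5 : swn W' + swn W = wn M := by
    unfold swn wn
    rw [← Finset.sum_add_distrib]
    refine Finset.sum_congr rfl fun i _ => ?_
    rw [← mul_add]
    congr 1
    exact Subspace.finrank_add_finrank_dualCoannihilator_eq (S i)
  have h6 : Module.finrank ℂ W'.S0 ≤ Module.finrank ℂ (LinearMap.ker (gW M S)) := by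
    have hmem : ∀ (w : W'.S0) i p, (D M).a i p w.1 ∈ W'.S i := fun w i p =>
      W'.ha i p (Submodule.mem_map_of_mem w.2)
    let L : W'.S0 →ₗ[ℂ] LinearMap.ker (gW M S) :=
      { toFun := fun w => ⟨fun i p => ⟨(D M).a i p w.1, hmem w i p⟩, by
          rw [LinearMap.mem_ker]
          ext v
          rw [gW_apply]
          have := w.1.2
          rw [LinearMap.mem_ker] at this
          have := LinearMap.congr_fun this v
          rw [g_apply] at this
          exact this⟩
        map_add' := fun x y => rfl
        map_smul' := fun c x => rfl }
    refine LinearMap.finrank_le_finrank_of_injective (f := L) ?_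
    intro x y hxy
    apply Subtype.ext
    apply Subtype.ext
    funext i p
    have := congrArg (fun z : LinearMap.ker (gW M S) => (z.1 i p).1) hxy
    exact this
  rw [wn_D]
  have e1 : Module.finrank ℂ W'.S0 + Module.finrank ℂ M.V0 ≤ Module.finrank ℂ W.S0 + swn W' := by
    omega
  zify at *
  nlinarith

theorem iso_DD {M : QRep χ N} (h : Inj M) : M.Iso (D (D M)) := by
  have d1 := finrank_D h
  have d2 := finrank_D (D_inj M)
  rw [wn_D] at d2
  let L : M.V0 →ₗ[ℂ] LinearMap.ker (g (D M)) :=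
    { toFun := fun v => ⟨fun i p => Module.Dual.eval ℂ (M.V i) (M.a i p v), by
          refine LinearMap.mem_ker.2 (LinearMap.ext fun φ => ?_)
          refine (g_apply (D M) _ φ).trans ?_
          have := φ.2
          rw [LinearMap.mem_ker] at this
          have := LinearMap.congr_fun this v
          rw [g_apply] at this
          exact this⟩
      map_add' := fun x y => by
        apply Subtype.ext
        funext i p
        exact ((Module.Dual.eval ℂ (M.V i)).comp (M.a i p)).map_add x y
      map_smul' := fun c x => by
        apply Subtype.ext
        funext i p
        exact ((Module.Dual.eval ℂ (M.V i)).comp (M.a i p)).map_smul c x }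
  have hL : Function.Injective L := by
    rw [← LinearMap.ker_eq_bot, eq_bot_iff]
    intro v hv
    refine h v fun i p => ?_
    have h1 : Module.Dual.eval ℂ (M.V i) (M.a i p v) = 0 :=
      congrArg (fun z : LinearMap.ker (g (D M)) => z.1 i p) hv
    exact (Module.evalEquiv ℂ (M.V i)).map_eq_zero_iff.1 h1
  refine ⟨LinearMap.linearEquivOfInjective (V₂ := (D (D M)).V0) L hL (by omega),
    fun i => Module.evalEquiv ℂ (M.V i), ?_, ?_⟩
  · intro i p v
    rfl
  · intro _ i x
    rfl

theorem iso_D {M M' : QRep χ N} (h : M.Iso M') : (D M).Iso (D M') := by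
  obtain ⟨e0, e, ha, hb⟩ := h
  let E : (∀ i : QIdx χ N, Fin i.val.2 → Module.Dual ℂ (M.V i)) ≃ₗ[ℂ]
      (∀ i : QIdx χ N, Fin i.val.2 → Module.Dual ℂ (M'.V i)) :=
    LinearEquiv.piCongrRight fun i => LinearEquiv.piCongrRight fun _ => (e i).symm.dualMap
  have hE : ∀ φ v, g M' (E φ) (e0 v) = g M φ v := by
    intro φ v
    rw [g_apply, g_apply]
    refine Finset.sum_congr rfl fun i _ => Finset.sum_congr rfl fun p _ => ?_
    rw [← ha]
    simp [E]
  have hmap : (LinearMap.ker (g M)).map (E : _ →ₗ[ℂ] _) = LinearMap.ker (g M') := by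
    ext ψ
    constructor
    · rintro ⟨φ, hφ, rfl⟩
      rw [LinearMap.mem_ker]
      ext v
      obtain ⟨v, rfl⟩ := e0.surjective v
      have hφ' : g M φ = 0 := hφ
      have := hE φ v
      rw [hφ'] at this
      exact this
    · intro hψ
      obtain ⟨φ, rfl⟩ := E.surjective ψ
      refine ⟨φ, ?_, rfl⟩
      have hψ' : g M' (E φ) = 0 := hψ
      change g M φ = 0
      ext v
      rw [← hE, hψ']
      rfl
  refine ⟨E.ofSubmodules _ _ hmap, fun i => (e i).symm.dualMap, ?_, ?_⟩
  · intro i p v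
    rfl
  · intro hχ i x
    apply LinearMap.ext
    intro y
    suffices hy : M.b i ((e i).symm y) = (e i).symm (M'.b i y) from
      congrArg (DFunLike.coe (F := Module.Dual ℂ (M.V i)) x) hy
    apply (e i).injective
    rw [hb hχ]
    simp

theorem dual_mem {θr θn : ℂ} (hr : 0 < θr.im) (hn : 0 < θn.im) (harg : θn.arg < θr.arg)
    {nv : QIdx χ N → ℕ} (hnv : nv ≠ 0) {s t : ℤ}
    (hst : s + t = ∑ i : QIdx χ N, (i.val.2 : ℤ) * (nv i : ℤ))
    (M : SemistableOfDim χ N θr θn s nv) :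
    Inj M.val ∧ ((D M.val).Semistable θr θn ∧ (Module.finrank ℂ (D M.val).V0 : ℤ) = t ∧
      ∀ i, Module.finrank ℂ ((D M.val).V i) = nv i) := by
  obtain ⟨M, hs, h0, hd⟩ := M
  change Inj M ∧ ((D M).Semistable θr θn ∧ (Module.finrank ℂ (D M).V0 : ℤ) = t ∧
      ∀ i, Module.finrank ℂ ((D M).V i) = nv i)
  have hw : wn M = ∑ i : QIdx χ N, i.val.2 * nv i := by
    unfold wn
    exact Finset.sum_congr rfl fun i _ => by rw [hd]
  have hM : 0 < wn M := by
    obtain ⟨i, hi⟩ := Function.ne_iff.1 hnv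
    rw [hw]
    refine Finset.sum_pos' (fun _ _ => Nat.zero_le _) ⟨i, Finset.mem_univ i, ?_⟩
    exact Nat.mul_pos (idx_pos i) (Nat.pos_of_ne_zero hi)
  have hc := (semistable_iff hr hn harg M hM).1 hs
  have hi := inj_of_crit hM hc
  refine ⟨hi, (semistable_iff hr hn harg (D M) (by rwa [wn_D])).2 (crit_D hM hc), ?_, ?_⟩
  · have h1 := finrank_D hi
    zify at h1 hw
    linarith
  · intro i
    rw [← hd i]
    exact Subspace.dual_finrank_eq

noncomputable def DS {θr θn : ℂ} (hr : 0 < θr.im) (hn : 0 < θn.im) (harg : θn.arg < θr.arg)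
    {nv : QIdx χ N → ℕ} (hnv : nv ≠ 0) {s t : ℤ}
    (hst : s + t = ∑ i : QIdx χ N, (i.val.2 : ℤ) * (nv i : ℤ))
    (M : SemistableOfDim χ N θr θn s nv) : SemistableOfDim χ N θr θn t nv :=
  ⟨D M.val, (dual_mem hr hn harg hnv hst M).2⟩

end QAux


/-- For the stability condition `Z_Q^+`
(i.e. `arg θr > arg θn`) and a dimension vector `(r, 𝐧)` with `𝐧 ≠ 0`,
setting `n := Σ_{(j,k)} k·𝐧_{j,k}`, the set of isomorphism classes of
semistable representations of `Q_{χ,N}` with dimension vector `(r, 𝐧)` is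
in bijection with the one for dimension vector `(n − r, 𝐧)`. -/
theorem semistable_symmetry (χ : ℤ) (N : ℕ) (hN : 0 < N)
    (θr θn : ℂ) (hr : 0 < θr.im) (hn : 0 < θn.im) (harg : θn.arg < θr.arg)
    (r : ℕ) (nv : QIdx χ N → ℕ) (hnv : nv ≠ 0) :
    Nonempty
      (Quot (fun M M' : SemistableOfDim χ N θr θn r nv => M.val.Iso M'.val) ≃
       Quot (fun M M' : SemistableOfDim χ N θr θn
          ((∑ i : QIdx χ N, (i.val.2 : ℤ) * (nv i : ℤ)) - r) nv =>
          M.val.Iso M'.val)) := by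
  have h1 : (r : ℤ) + ((∑ i : QIdx χ N, (i.val.2 : ℤ) * (nv i : ℤ)) - r) =
      ∑ i : QIdx χ N, (i.val.2 : ℤ) * (nv i : ℤ) := by ring
  have h2 : ((∑ i : QIdx χ N, (i.val.2 : ℤ) * (nv i : ℤ)) - r) + (r : ℤ) =
      ∑ i : QIdx χ N, (i.val.2 : ℤ) * (nv i : ℤ) := by ring
  refine ⟨⟨Quot.map (QAux.DS hr hn harg hnv h1) fun _ _ h => QAux.iso_D h,
    Quot.map (QAux.DS hr hn harg hnv h2) fun _ _ h => QAux.iso_D h, ?_, ?_⟩⟩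
  · rintro ⟨M⟩
    refine Eq.symm (Quot.sound (a := M) (b := QAux.DS hr hn harg hnv h2 (QAux.DS hr hn harg hnv h1 M)) ?_)
    exact QAux.iso_DD (QAux.dual_mem hr hn harg hnv h1 M).1
  · rintro ⟨M⟩
    refine Eq.symm (Quot.sound (a := M) (b := QAux.DS hr hn harg hnv h1 (QAux.DS hr hn harg hnv h2 M)) ?_)
    exact QAux.iso_DD (QAux.dual_mem hr hn harg hnv h2 M).1
end

section
/- Assume χ > 0 and arg θ_r > arg θ_n (the stability condition Z_Q^+). For every f : J → ℕ the representation V(f) of Q_{χ,N} is Z-semistable, and for f, f' : J → ℕ the representations V(f) and V(f') are isomorphic if and only if f = f'. -/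
/-- For `χ > 0` and `f : J → ℕ` (where `J = {(j,k,p)}` indexes the arrows
`a_{j,k,p}`), the representation `V(f)`: `V(f)₀ = ℂ·v₀`,
`V(f)_{j,k} = ⊕_{p≤k} ⊕_{a≤f(j,k,p)} ℂ·v_{j,k,p,a}`, with
`a_{j,k,p}(v₀) = v_{j,k,p,1}` (or `0` if `f(j,k,p) = 0`) and
`b_{j,k}(v_{j,k,p,a}) = v_{j,k,p,a+1}` (or `0` if `a = f(j,k,p)`).
Here `v_{j,k,p,a}` (for `1 ≤ a ≤ f(j,k,p)`) is encoded as the standard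
basis vector with index `a - 1 : Fin (f(j,k,p))`. -/
noncomputable def repOfF (χ : ℤ) (N : ℕ) (hχ : 0 < χ)
    (f : (Σ i : QIdx χ N, Fin i.val.2) → ℕ) : QRep χ N where
  V0 := ℂ
  V := fun i => ∀ p : Fin i.val.2, Fin (f ⟨i, p⟩) → ℂ
  a := fun i p =>
    { toFun := fun c => fun p' a' =>
        if p' = p ∧ (a' : ℕ) = 0 then c else 0
      map_add' := by
        intro x y
        funext p' a'
        by_cases h : p' = p ∧ (a' : ℕ) = 0 <;> simp [h]
      map_smul' := by
        intro c x
        funext p' a'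
        by_cases h : p' = p ∧ (a' : ℕ) = 0 <;> simp [h] }
  b := fun i =>
    { toFun := fun x => fun p a =>
        if h : 0 < (a : ℕ) then
          x p ⟨(a : ℕ) - 1, by have := a.isLt; omega⟩ else 0
      map_add' := by
        intro x y
        funext p a
        by_cases h : 0 < (a : ℕ) <;> simp [h]
      map_smul' := by
        intro c x
        funext p a
        by_cases h : 0 < (a : ℕ) <;> simp [h] }
  b_eq_zero := fun h => absurd hχ (not_lt.mpr h)

theorem cross_pos_of_arg_lt {z w : ℂ} (hz : 0 < z.im) (hw : 0 < w.im) (h : z.arg < w.arg) :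
    0 < w.im * z.re - w.re * z.im := by
  have h1 := Complex.norm_mul_cos_arg z
  have h2 := Complex.norm_mul_sin_arg z
  have h3 := Complex.norm_mul_cos_arg w
  have h4 := Complex.norm_mul_sin_arg w
  have hz0 : 0 < ‖z‖ := norm_pos_iff.mpr (by rintro rfl; simp at hz)
  have hw0 : 0 < ‖w‖ := norm_pos_iff.mpr (by rintro rfl; simp at hw)
  have hza : 0 ≤ z.arg := Complex.arg_nonneg_iff.mpr hz.le
  have hza' : z.arg ≠ 0 := by
    intro h0
    rw [h0] at h2
    simp at h2
    linarith
  have hza'' : 0 < z.arg := lt_of_le_of_ne hza (Ne.symm hza')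
  have hs : 0 < Real.sin (w.arg - z.arg) :=
    Real.sin_pos_of_pos_of_lt_pi (by linarith) (by linarith [Complex.arg_le_pi w])
  rw [Real.sin_sub] at hs
  have := mul_pos (mul_pos hw0 hz0) hs
  calc 0 < _ := this
    _ = (‖w‖ * Real.sin w.arg) * (‖z‖ * Real.cos z.arg) -
        (‖w‖ * Real.cos w.arg) * (‖z‖ * Real.sin z.arg) := by ring
    _ = _ := by rw [h1, h2, h3, h4]

theorem arg_le_add_aux {z w : ℂ} (hz : 0 < z.im) (hw : 0 < w.im) (h : z.arg < w.arg)
    (m : ℕ) : z.arg ≤ (w + m * z).arg := by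
  have hc := cross_pos_of_arg_lt hz hw h
  by_contra! hlt
  have him : 0 < (w + m * z).im := by
    simp
    positivity
  have := cross_pos_of_arg_lt him hz hlt
  simp at this
  nlinarith

theorem repOfF_pow_apply (χ : ℤ) (N : ℕ) (hχ : 0 < χ)
    (f : (Σ i : QIdx χ N, Fin i.val.2) → ℕ) (i : QIdx χ N) (p : Fin i.val.2) (c : ℂ) (n : ℕ) :
    ((((repOfF χ N hχ f).b i)^[n] ((repOfF χ N hχ f).a i p c)) :
      ∀ p : Fin i.val.2, Fin (f ⟨i, p⟩) → ℂ) =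
      fun (p' : Fin i.val.2) (a' : Fin (f ⟨i, p'⟩)) => if p' = p ∧ (a' : ℕ) = n then c else 0 := by
  induction n with
  | zero => rfl
  | succ n ih =>
    rw [Function.iterate_succ_apply']
    erw [ih]
    funext p' a'
    change (if h : 0 < (a' : ℕ) then
          (if p' = p ∧ (a' : ℕ) - 1 = n then c else 0) else 0) = _
    by_cases h : 0 < (a' : ℕ)
    · have : (a' : ℕ) - 1 = n ↔ (a' : ℕ) = n + 1 := by omega
      simp only [h, this, dite_true]
    · have : ¬ (a' : ℕ) = n + 1 := by omega
      simp [h, this]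

theorem repOfF_pow_eq_zero_iff (χ : ℤ) (N : ℕ) (hχ : 0 < χ)
    (f : (Σ i : QIdx χ N, Fin i.val.2) → ℕ) (i : QIdx χ N) (p : Fin i.val.2) (c : ℂ)
    (hc : c ≠ 0) (n : ℕ) :
    ((repOfF χ N hχ f).b i)^[n] ((repOfF χ N hχ f).a i p c) = 0 ↔ f ⟨i, p⟩ ≤ n := by
  have key := repOfF_pow_apply χ N hχ f i p c n
  constructor
  · intro h
    by_contra! hlt
    rw [h] at key
    have := congrFun (congrFun key p) ⟨n, hlt⟩
    simp at this
    exact hc this.symm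
  · intro h
    refine key.trans ?_
    funext p' a'
    have : ¬ (p' = p ∧ (a' : ℕ) = n) := by
      rintro ⟨rfl, h2⟩
      have := a'.isLt
      omega
    simp only [this, if_false]
    rfl

theorem repOfF_sub_top (χ : ℤ) (N : ℕ) (hχ : 0 < χ)
    (f : (Σ i : QIdx χ N, Fin i.val.2) → ℕ) (W : QSub (repOfF χ N hχ f))
    (h0 : W.S0 = ⊤) (i : QIdx χ N) : W.S i = ⊤ := by
  have hmem : ∀ (p : Fin i.val.2) (c : ℂ) (n : ℕ),
      ((repOfF χ N hχ f).b i)^[n] ((repOfF χ N hχ f).a i p c) ∈ W.S i := by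
    intro p c n
    induction n with
    | zero => exact W.ha i p ⟨c, by rw [h0]; exact Submodule.mem_top, rfl⟩
    | succ n ih =>
      rw [Function.iterate_succ_apply']
      exact W.hb hχ i ⟨_, ih, rfl⟩
  rw [eq_top_iff]
  intro x _
  have hx : x = ∑ p : Fin i.val.2, ∑ a : Fin (f ⟨i, p⟩),
      ((repOfF χ N hχ f).b i)^[(a : ℕ)] ((repOfF χ N hχ f).a i p
        ((x : ∀ p : Fin i.val.2, Fin (f ⟨i, p⟩) → ℂ) p a)) := by
    have : ∀ x : ∀ p : Fin i.val.2, Fin (f ⟨i, p⟩) → ℂ,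
      x = ∑ p : Fin i.val.2, ∑ a : Fin (f ⟨i, p⟩),
        (fun (p' : Fin i.val.2) (a' : Fin (f ⟨i, p'⟩)) => if p' = p ∧ (a' : ℕ) = (a : ℕ) then x p a else 0) := by
      intro x
      funext p' a'
      simp only [Finset.sum_apply]
      rw [Finset.sum_eq_single p', Finset.sum_eq_single a']
      · simp
      · intro b _ hb
        have : ¬ (a' : ℕ) = (b : ℕ) := fun h => hb (Fin.ext h.symm)
        simp [this]
      · simp
      · intro b _ hb
        simp [Ne.symm hb]
      · simp
    refine (this x).trans ?_
    refine Finset.sum_congr rfl fun p _ => Finset.sum_congr rfl fun a _ => ?_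
    exact (repOfF_pow_apply χ N hχ f i p _ a).symm
  rw [hx]
  exact Submodule.sum_mem _ fun p _ => Submodule.sum_mem _ fun a _ => hmem p _ a

/-- Assume `χ > 0` and `arg θr > arg θn` (the stability
condition `Z_Q^+`).  Every `V(f)` is semistable, and `V(f) ≅ V(f')` iff
`f = f'`. -/
theorem repOfF_semistable_and_iso_iff (χ : ℤ) (hχ : 0 < χ) (N : ℕ) (hN : 0 < N)
    (θr θn : ℂ) (hr : 0 < θr.im) (hn : 0 < θn.im) (harg : θn.arg < θr.arg) :
    (∀ f : (Σ i : QIdx χ N, Fin i.val.2) → ℕ,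
      (repOfF χ N hχ f).Semistable θr θn) ∧
    (∀ f f' : (Σ i : QIdx χ N, Fin i.val.2) → ℕ,
      (repOfF χ N hχ f).Iso (repOfF χ N hχ f') ↔ f = f') := by
  refine ⟨fun f W hbot htop => ?_, fun f f' => ⟨?_, ?_⟩⟩
  · have h1 : Module.finrank ℂ (repOfF χ N hχ f).V0 = 1 := Module.finrank_self ℂ
    have hS0 : W.S0 = ⊥ := by
      have : ∀ S : Submodule ℂ ℂ, S = ⊥ ∨ S = ⊤ := fun S => eq_bot_or_eq_top S
      rcases this W.S0 with h | h
      · exact h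
      · exact absurd ⟨h, repOfF_sub_top χ N hχ f W h⟩ htop
    have hZ : W.Z θr θn =
        ((∑ i : QIdx χ N, i.val.2 * Module.finrank ℂ (W.S i) : ℕ) : ℂ) * θn := by
      rw [QSub.Z, hS0, finrank_bot]
      push_cast
      ring
    have hM : (repOfF χ N hχ f).Z θr θn = θr +
        ((∑ i : QIdx χ N, i.val.2 * Module.finrank ℂ ((repOfF χ N hχ f).V i) : ℕ) : ℂ) * θn := by
      rw [QRep.Z, h1]
      push_cast
      ring
    have hpos : 0 < ∑ i : QIdx χ N, i.val.2 * Module.finrank ℂ (W.S i) := by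
      by_contra! hle
      apply hbot
      refine ⟨hS0, fun i => ?_⟩
      have hz := (Finset.sum_eq_zero_iff.mp (Nat.le_zero.mp hle)) i (Finset.mem_univ i)
      have hi := (Finset.mem_Icc.mp (Finset.mem_product.mp i.2).2).1
      rcases Nat.mul_eq_zero.mp hz with h | h
      · omega
      · exact Submodule.finrank_eq_zero.mp h
    rw [hZ, hM]
    have : (((∑ i : QIdx χ N, i.val.2 * Module.finrank ℂ (W.S i) : ℕ) : ℂ) * θn).arg = θn.arg := by
      rw [← Complex.ofReal_natCast]
      exact Complex.arg_real_mul θn (by exact_mod_cast hpos)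
    rw [this]
    exact arg_le_add_aux hn hr harg _
  · rintro ⟨e0, e, ha, hb⟩
    have hc : e0 (1 : ℂ) ≠ (0 : ℂ) := fun h =>
      one_ne_zero (α := ℂ) (e0.map_eq_zero_iff.mp h)
    funext ⟨i, p⟩
    have key : ∀ n, e i (((repOfF χ N hχ f).b i)^[n] ((repOfF χ N hχ f).a i p (1 : ℂ))) =
        ((repOfF χ N hχ f').b i)^[n] ((repOfF χ N hχ f').a i p (e0 (1 : ℂ))) := by
      intro n
      induction n with
      | zero => exact ha i p _
      | succ n ih => rw [Function.iterate_succ_apply', Function.iterate_succ_apply', hb hχ, ih]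
    have hiff : ∀ n, f ⟨i, p⟩ ≤ n ↔ f' ⟨i, p⟩ ≤ n := by
      intro n
      rw [← repOfF_pow_eq_zero_iff χ N hχ f i p 1 one_ne_zero n,
        ← repOfF_pow_eq_zero_iff χ N hχ f' i p (e0 (1 : ℂ)) hc n, ← key n]
      exact (e i).map_eq_zero_iff.symm
    exact le_antisymm ((hiff _).mpr le_rfl) ((hiff _).mp le_rfl)
  · rintro rfl
    exact ⟨LinearEquiv.refl _ _, fun i => LinearEquiv.refl _ _, fun _ _ _ => rfl,
      fun _ _ _ => rfl⟩
end
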